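/- Scaled asymptotics for Ramanujan's entire function: let (λ_n) be an admissible scale, q = e^{-π/λ_n}, z = e^{2πv} with v ∈ ℝ, and A_q(z) = Σ_{k=0}^∞ q^{k²} (-z)^k / (q;q)_k. Then A_q(-q^{-4n} z) = (1/√2) exp{πλ_n(v + 2n/λ_n)² + πλ_n/6 - π/(24λ_n)} (1 + O(e^{-πλ_n})) as n → ∞, uniformly for v in any compact subset of ℝ. -/

import Mathlib

open Filter Real

noncomputable def Pk (q : ℝ) (k : ℕ) : ℝ := ∏ j ∈ Finset.range k, (1 - q ^ (j + 1))

noncomputable def PI (q : ℝ) : ℝ := ∏' j : ℕ, (1 - q ^ (j + 1))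

lemma Pk_pos {q : ℝ} (h0 : 0 < q) (h1 : q < 1) (k : ℕ) : 0 < Pk q k := by
  unfold Pk
  apply Finset.prod_pos
  intro j _
  have := pow_lt_one₀ h0.le h1 (Nat.succ_ne_zero j)
  simp only [Nat.succ_eq_add_one] at this
  linarith

lemma PI_multipliable {q : ℝ} (h0 : 0 < q) (h1 : q < 1) :
    Multipliable (fun j : ℕ => (1 - q ^ (j + 1))) := by
  have : Summable (fun j : ℕ => ‖-q ^ (j + 1)‖) := by
    simp only [norm_neg, norm_pow, Real.norm_eq_abs, abs_of_pos h0]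
    exact (summable_nat_add_iff 1).2 (summable_geometric_of_lt_one h0.le h1)
  simpa [sub_eq_add_neg] using multipliable_one_add_of_summable this

lemma Pk_tendsto {q : ℝ} (h0 : 0 < q) (h1 : q < 1) :
    Tendsto (Pk q) atTop (nhds (PI q)) := by
  have hm := PI_multipliable h0 h1
  exact hm.hasProd.tendsto_prod_nat

lemma Pk_lower {q : ℝ} (h0 : 0 < q) (h1 : q < 1) (k m : ℕ) :
    Pk q k * (1 - (q ^ (k + 1) - q ^ (k + m + 1)) / (1 - q)) ≤ Pk q (k + m)
      ∧ Pk q (k + m) ≤ Pk q k := by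
  have h1q : 0 < 1 - q := by linarith
  induction m with
  | zero => simp
  | succ m ih =>
    have e : Pk q (k + (m + 1)) = Pk q (k + m) * (1 - q ^ (k + m + 1)) := by
      unfold Pk
      rw [← add_assoc, Finset.prod_range_succ]
    have hp : 0 < q ^ (k + m + 1) := by positivity
    have hpos := Pk_pos h0 h1 (k + m)
    obtain ⟨i1, i2⟩ := ih
    have hx := mul_pos hpos hp
    constructor
    · have e2 : (q ^ (k + 1) - q ^ (k + (m + 1) + 1)) / (1 - q) =
        (q ^ (k + 1) - q ^ (k + m + 1)) / (1 - q) + q ^ (k + m + 1) := by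
        field_simp
        ring
      have := mul_le_mul_of_nonneg_right i2 hp.le
      rw [e, e2]
      linarith
    · rw [e]
      linarith

lemma PI_bounds {q : ℝ} (h0 : 0 < q) (h1 : q < 1) (k : ℕ) :
    Pk q k * (1 - q ^ (k + 1) / (1 - q)) ≤ PI q ∧ PI q ≤ Pk q k := by
  have h1q : 0 < 1 - q := by linarith
  have ht : Tendsto (fun m => Pk q (k + m)) atTop (nhds (PI q)) := by
    have := (tendsto_add_atTop_iff_nat k).2 (Pk_tendsto h0 h1)
    simpa [add_comm] using this
  constructor
  · refine ge_of_tendsto' ht (fun m => le_trans ?_ (Pk_lower h0 h1 k m).1)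
    apply mul_le_mul_of_nonneg_left _ (Pk_pos h0 h1 k).le
    have : 0 < q ^ (k + m + 1) := by positivity
    gcongr
    linarith
  · exact le_of_tendsto' ht (fun m => (Pk_lower h0 h1 k m).2)

lemma csqrt_exp {z : ℂ} (hz : z ≠ 0) : Complex.sqrt z = Complex.exp (Complex.log z / 2) := by
  simp [Complex.sqrt, Complex.cpow_def, hz, div_eq_mul_inv]

lemma exp_zpow (x : ℝ) (k : ℤ) : Real.exp (k * x) = Real.exp x ^ k := by
  rw [mul_comm, Real.exp_mul, Real.rpow_intCast]

open Complex in
lemma eta_im (x : ℝ) (_hx : 0 < x) :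
    ModularForm.eta (I * x) = ((Real.exp (-π * x / 12) * PI (Real.exp (-2 * π * x)) : ℝ) : ℂ) := by
  unfold ModularForm.eta PI
  push_cast
  congr 1
  · unfold Function.Periodic.qParam
    congr 1
    push_cast
    linear_combination (2 * π * x / 24 : ℂ) * I_sq
  · have hq1 : Real.exp (-2 * π * x) < 1 := by
      rw [Real.exp_lt_one_iff]
      nlinarith [mul_pos Real.pi_pos _hx]
    have hm := PI_multipliable (Real.exp_pos (-2 * π * x)) hq1
    have := hm.map_tprod Complex.ofRealHom Complex.continuous_ofReal
    simp only [Complex.ofRealHom_eq_coe] at this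
    rw [this]
    refine tprod_congr (fun j => ?_)
    rw [ModularForm.eta_q_eq_pow]
    push_cast
    congr 3
    linear_combination (2 * π * x : ℂ) * I_sq

open Complex in
lemma PI_modular (l : ℝ) (hl : 0 < l) :
    PI (Real.exp (-π / l)) = √(2 * l) * Real.exp (π / (24 * l) - π * l / 6)
      * PI (Real.exp (-4 * π * l)) := by
  have h := ModularForm.eta_comp_eq_csqrt_I_inv (x := I * ((2 * l : ℝ) : ℂ)) (by
    simp [UpperHalfPlane.upperHalfPlaneSet, hl])
  have e1 : -1 / (I * ((2 * l : ℝ) : ℂ)) = I * ((1 / (2 * l) : ℝ) : ℂ) := by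
    have : (l : ℂ) ≠ 0 := by exact_mod_cast hl.ne'
    push_cast
    field_simp
    simp
  have e2 : Complex.sqrt (I * ((2 * l : ℝ) : ℂ)) = (√(2 * l) : ℝ) * Complex.sqrt I := by
    have h2l : (((2 * l : ℝ)) : ℂ) ≠ 0 := by exact_mod_cast (by positivity : (2 * l : ℝ) ≠ 0)
    rw [mul_comm, csqrt_exp (mul_ne_zero h2l I_ne_zero), csqrt_exp I_ne_zero,
      Complex.log_ofReal_mul (by positivity) I_ne_zero, add_div, Complex.exp_add, Real.sqrt_eq_rpow,
      Real.rpow_def_of_pos (by positivity)]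
    push_cast
    congr 2
    ring
  have e3 : Complex.sqrt I ≠ 0 := by simp [Complex.sqrt]
  simp only [Function.comp, Pi.smul_apply, Pi.mul_apply, smul_eq_mul] at h
  rw [e1, e2, eta_im _ (by positivity), eta_im _ (by positivity)] at h
  have h' : ((Real.exp (-π * (1 / (2 * l)) / 12) * PI (Real.exp (-2 * π * (1 / (2 * l)))) : ℝ) : ℂ)
     = ((√(2 * l) * (Real.exp (-π * (2 * l) / 12) * PI (Real.exp (-2 * π * (2 * l)))) : ℝ) : ℂ) := by
    rw [h]
    push_cast
    field_simp
  have h2 := Complex.ofReal_injective h'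
  have e4 : -2 * π * (1 / (2 * l)) = -π / l := by field_simp
  have e5 : -2 * π * (2 * l) = -4 * π * l := by ring
  rw [e4, e5] at h2
  have e6 : Real.exp (π / (24 * l) - π * l / 6) =
      Real.exp (-π * (2 * l) / 12) / Real.exp (-π * (1 / (2 * l)) / 12) := by
    rw [← Real.exp_sub]
    congr 1
    field_simp
    ring
  rw [e6]
  have := Real.exp_pos (-π * (1 / (2 * l)) / 12)
  rw [mul_div_assoc', div_mul_eq_mul_div, eq_div_iff this.ne']
  linarith

noncomputable def gt (l v : ℝ) (m : ℤ) : ℝ := Real.exp (-π * (m : ℝ) ^ 2 / l + 2 * π * v * m)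

noncomputable def C0 : ℝ := ∑' m : ℤ, Real.exp (-π * ((m : ℝ) ^ 2 - 1))

lemma summable_gauss (a : ℝ) (ha : 0 < a) (b : ℝ) :
    Summable (fun m : ℤ => Real.exp (-π * a * (m : ℝ) ^ 2 + 2 * π * b * m)) := by
  have h := (summable_jacobiTheta₂_term_iff (-Complex.I * b) (Complex.I * a)).2 (by simpa using ha)
  have h2 := h.norm
  refine h2.congr (fun m => ?_)
  rw [jacobiTheta₂_term, Complex.norm_exp]
  congr 1
  have : (2 * π * Complex.I * m * (-Complex.I * b) + π * Complex.I * m ^ 2 * (Complex.I * a) : ℂ)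
    = ((-π * a * (m : ℝ) ^ 2 + 2 * π * b * m : ℝ) : ℂ) := by
    push_cast
    linear_combination (-2 * π * m * b + π * m^2 * a : ℂ) * Complex.I_sq
  rw [this, Complex.ofReal_re]

lemma gt_summable {l : ℝ} (hl : 0 < l) (v : ℝ) : Summable (gt l v) := by
  refine (summable_gauss (1 / l) (by positivity) v).congr (fun m => ?_)
  unfold gt
  congr 1
  ring

lemma C0_summable : Summable (fun m : ℤ => Real.exp (-π * ((m : ℝ) ^ 2 - 1))) := by
  refine ((summable_gauss 1 one_pos 0).mul_left (Real.exp π)).congr (fun m => ?_)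
  rw [← Real.exp_add]
  congr 1
  ring

lemma C0_nonneg : 0 ≤ C0 := tsum_nonneg (fun _ => (Real.exp_pos _).le)

lemma theta_est {l : ℝ} (hl : 1 ≤ l) (v : ℝ) :
    |∑' m, gt l v m - √l * Real.exp (π * l * v ^ 2)| ≤
      √l * Real.exp (π * l * v ^ 2) * (C0 * Real.exp (-π * l)) := by
  have hl0 : 0 < l := by linarith
  have hlc : (l : ℂ) ≠ 0 := by exact_mod_cast hl0.ne'
  have h := Complex.tsum_exp_neg_quadratic (a := ((1 / l : ℝ) : ℂ)) (by
    rw [Complex.ofReal_re]; positivity) (v : ℂ)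
  have hL : (∑' n : ℤ, Complex.exp (-π * ((1 / l : ℝ) : ℂ) * n ^ 2 + 2 * π * v * n)) =
      ((∑' m, gt l v m : ℝ) : ℂ) := by
    rw [Complex.ofReal_tsum]
    refine tsum_congr (fun m => ?_)
    unfold gt
    push_cast
    congr 1
    ring
  have hs : (1 : ℂ) / ((1 / l : ℝ) : ℂ) ^ (1 / 2 : ℂ) = ((√l : ℝ) : ℂ) := by
    rw [show (1 / 2 : ℂ) = ((1 / 2 : ℝ) : ℂ) by push_cast; rfl, ← Complex.ofReal_cpow (by positivity),
      ← Real.sqrt_eq_rpow, one_div l, Real.sqrt_inv]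
    push_cast
    simp
  rw [hL, hs] at h
  set F : ℤ → ℂ := fun n => Complex.exp (-π / ((1 / l : ℝ) : ℂ) * (n + Complex.I * v) ^ 2) with hF
  have hnorm : ∀ n : ℤ, ‖F n‖ = Real.exp (π * l * v ^ 2) * Real.exp (-π * l * (n : ℝ) ^ 2) := by
    intro n
    rw [hF, Complex.norm_exp, ← Real.exp_add]
    congr 1
    have : (-π / ((1 / l : ℝ) : ℂ) * (n + Complex.I * v) ^ 2 : ℂ) =
      ((π * l * v ^ 2 + -π * l * (n : ℝ) ^ 2 : ℝ) : ℂ) + ((-2 * π * l * n * v : ℝ) : ℂ) * Complex.I := by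
      push_cast
      field_simp
      linear_combination (-v^2 : ℂ) * Complex.I_sq
    rw [this, Complex.add_re, Complex.ofReal_re, Complex.re_ofReal_mul]
    simp
  have hFs : Summable F := by
    apply Summable.of_norm
    simp_rw [hnorm]
    apply Summable.mul_left
    simpa using summable_gauss l hl0 0
  have hF0 : F 0 = ((Real.exp (π * l * v ^ 2) : ℝ) : ℂ) := by
    rw [hF]
    push_cast
    congr 1
    push_cast
    field_simp
    linear_combination (-v^2 : ℂ) * Complex.I_sq
  have hsplit := hFs.tsum_eq_add_tsum_ite 0
  have hb : ‖∑' n : ℤ, (if n = 0 then 0 else F n)‖ ≤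
      Real.exp (π * l * v ^ 2) * (C0 * Real.exp (-π * l)) := by
    refine tsum_of_norm_bounded (g := fun n : ℤ => Real.exp (π * l * v ^ 2) *
      (Real.exp (-π * ((n : ℝ) ^ 2 - 1)) * Real.exp (-π * l))) ?_ ?_
    · exact (C0_summable.hasSum.mul_right _).mul_left _
    · intro n
      split_ifs with h0
      · simp only [norm_zero]; positivity
      · rw [hnorm, ← Real.exp_add (-π * _)]
        have h1 : (1 : ℝ) ≤ (n : ℝ) ^ 2 := by
          have : 1 ≤ n ^ 2 := by
            have := sq_pos_of_ne_zero (a := n) h0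
            omega
          exact_mod_cast this
        gcongr
        have := mul_nonneg Real.pi_pos.le (mul_nonneg (sub_nonneg.2 hl) (sub_nonneg.2 h1))
        nlinarith
  have key : ((∑' m, gt l v m - √l * Real.exp (π * l * v ^ 2) : ℝ) : ℂ) =
      ((√l : ℝ) : ℂ) * ∑' n : ℤ, (if n = 0 then 0 else F n) := by
    push_cast
    push_cast at h hF0
    rw [h, hsplit, hF0]
    ring
  have := congrArg norm key
  rw [Complex.norm_real, norm_mul, Complex.norm_real, Real.norm_eq_abs, Real.norm_eq_abs,
    abs_of_nonneg (Real.sqrt_nonneg l)] at this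
  rw [this, mul_assoc]
  exact mul_le_mul_of_nonneg_left hb (Real.sqrt_nonneg l)

lemma inv_one_sub_q {l : ℝ} (hl : 1 ≤ l) : 1 / (1 - Real.exp (-π / l)) ≤ Real.exp l := by
  have hl0 : 0 < l := by linarith
  have hx : 0 < π / l := by positivity
  have h1 : Real.exp (-π / l) * (1 + π / l) ≤ 1 := by
    have : 1 + π / l ≤ Real.exp (π / l) := by linarith [Real.add_one_le_exp (π / l)]
    calc _ ≤ Real.exp (-π / l) * Real.exp (π / l) := by gcongr
      _ = 1 := by rw [← Real.exp_add, neg_div]; simp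
  have hq : Real.exp (-π / l) < 1 := by
    rw [Real.exp_lt_one_iff, neg_div]; linarith
  have hc : 1 + l ≤ Real.exp l := by linarith [Real.add_one_le_exp l]
  refine le_trans ?_ hc
  rw [div_le_iff₀ (by linarith)]
  have h2 : (1 + l) * Real.exp (-π / l) ≤ l := by
    have h3 : 1 + 1 / l ≤ 1 + π / l := by
      have := Real.pi_gt_three
      gcongr
      linarith
    have h4 : Real.exp (-π / l) * (1 + 1 / l) ≤ 1 :=
      le_trans (mul_le_mul_of_nonneg_left h3 (Real.exp_pos _).le) h1
    have h5 : (1 + l) = l * (1 + 1 / l) := by field_simp; ring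
    rw [h5]
    nlinarith
  linarith

noncomputable def cc (q : ℝ) (k : ℤ) : ℝ := if 0 ≤ k then PI q / Pk q k.toNat else 0

lemma cc_est {q : ℝ} (h0 : 0 < q) (h1 : q < 1) (k : ℤ) :
    |cc q k - 1| ≤ q ^ (k + 1) / (1 - q) := by
  have h1q : 0 < 1 - q := by linarith
  unfold cc
  split_ifs with hk
  · obtain ⟨b1, b2⟩ := PI_bounds h0 h1 k.toNat
    have hp := Pk_pos h0 h1 k.toNat
    have e : q ^ (k + 1) = q ^ (k.toNat + 1) := by
      rw [← zpow_natCast]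
      congr 1
      push_cast
      rw [Int.toNat_of_nonneg hk]
    rw [e, abs_le]
    constructor
    · have : 1 - q ^ (k.toNat + 1) / (1 - q) ≤ PI q / Pk q k.toNat := by
        rw [le_div_iff₀ hp]; linarith
      linarith
    · have : PI q / Pk q k.toNat ≤ 1 := by rw [div_le_one hp]; exact b2
      have h : 0 < q ^ (k.toNat + 1) / (1 - q) := by positivity
      linarith
  · have : 1 ≤ q ^ (k + 1) := by
      rw [show k + 1 = -(((-(k+1)).toNat : ℕ) : ℤ) by omega, zpow_neg, zpow_natCast]
      exact (one_le_inv₀ (by positivity)).2 (pow_le_one₀ h0.le h1.le)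
    simp only [zero_sub, abs_neg, abs_one]
    rw [le_div_iff₀ h1q]
    linarith

set_option maxHeartbeats 1000000 in
lemma core {l : ℝ} (hl : 1 ≤ l) (n : ℕ) (hn : l ^ 2 ≤ n) (M v : ℝ) (hv : |v| ≤ M) :
    |∑' k : ℕ, gt l v ((k : ℤ) - 2 * n) * (PI (Real.exp (-π / l)) / Pk (Real.exp (-π / l)) k)
      - √l * Real.exp (π * l * v ^ 2)| ≤
      √l * Real.exp (π * l * v ^ 2) * ((C0 + (1 + C0) * Real.exp (π * M)) * Real.exp (-π * l)) := by
  have hl0 : 0 < l := by linarith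
  set q := Real.exp (-π / l) with hq
  have hq0 : 0 < q := Real.exp_pos _
  have hq1 : q < 1 := by
    rw [hq, Real.exp_lt_one_iff, neg_div]
    have : 0 < π / l := by positivity
    linarith
  have h1q : 0 < 1 - q := by linarith
  set f : ℤ → ℝ := fun k => gt l v (k - 2 * n) with hf
  have hfs : Summable f := (Equiv.subRight (2 * (n : ℤ))).summable_iff.2 (gt_summable hl0 v)
  have hft : ∑' k, f k = ∑' m, gt l v m := (Equiv.subRight (2 * (n : ℤ))).tsum_eq (gt l v)
  have hfpos : ∀ k, 0 < f k := fun k => Real.exp_pos _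
  -- the majorant
  set v' := v - 1 / (2 * l) with hv'
  have hg : ∀ k : ℤ, f k * (q ^ (k + 1) / (1 - q)) =
      gt l v' (k - 2 * n) * (q ^ (2 * n + 1) / (1 - q)) := by
    intro k
    have : f k * q ^ (k + 1) = gt l v' (k - 2 * n) * q ^ (2 * n + 1) := by
      rw [hf, hq]
      simp only [gt]
      rw [← exp_zpow, ← Real.exp_nat_mul, ← Real.exp_add, ← Real.exp_add]
      congr 1
      rw [hv']
      push_cast
      field_simp
      ring
    rw [mul_div_assoc', this, mul_div_assoc']
  have hgs : Summable (fun k : ℤ => gt l v' (k - 2 * n)) :=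
    (Equiv.subRight (2 * (n : ℤ))).summable_iff.2 (gt_summable hl0 v')
  have hgt : ∑' k : ℤ, gt l v' (k - 2 * n) = ∑' m, gt l v' m :=
    (Equiv.subRight (2 * (n : ℤ))).tsum_eq (gt l v')
  have hdb : ∀ k, ‖f k * (cc q k - 1)‖ ≤ gt l v' (k - 2 * n) * (q ^ (2 * n + 1) / (1 - q)) := by
    intro k
    rw [← hg, norm_mul, Real.norm_eq_abs, Real.norm_eq_abs, abs_of_pos (hfpos k)]
    exact mul_le_mul_of_nonneg_left (cc_est hq0 hq1 k) (hfpos k).le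
  have hds : Summable (fun k => f k * (cc q k - 1)) :=
    Summable.of_norm_bounded (hgs.mul_right _) hdb
  have hd : |∑' k, f k * (cc q k - 1)| ≤ (∑' m, gt l v' m) * (q ^ (2 * n + 1) / (1 - q)) := by
    rw [← hgt, ← tsum_mul_right, ← Real.norm_eq_abs]
    exact tsum_of_norm_bounded (hgs.mul_right _).hasSum hdb
  have hsum : ∑' k : ℤ, f k * cc q k = ∑' m, gt l v m + ∑' k, f k * (cc q k - 1) := by
    rw [← hft, ← hfs.tsum_add hds]
    exact tsum_congr (fun k => by ring)
  have hnat : ∑' k : ℕ, gt l v ((k : ℤ) - 2 * n) * (PI q / Pk q k) = ∑' k : ℤ, f k * cc q k := by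
    rw [← (Nat.cast_injective (R := ℤ)).tsum_eq (f := fun k => f k * cc q k)]
    · refine tsum_congr (fun k => ?_)
      simp [hf, cc]
    · intro k hk
      simp only [Function.mem_support] at hk
      by_cases h : 0 ≤ k
      · exact ⟨k.toNat, Int.toNat_of_nonneg h⟩
      · exact absurd (by simp [cc, h]) hk
  have t1 := theta_est hl v
  have t2 := theta_est hl v'
  have hC := C0_nonneg
  have hS' : ∑' m, gt l v' m ≤ √l * Real.exp (π * l * v' ^ 2) * (1 + C0) := by
    have : Real.exp (-π * l) ≤ 1 := by
      rw [Real.exp_le_one_iff]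
      nlinarith [Real.pi_pos]
    have h3 : C0 * Real.exp (-π * l) ≤ C0 := by nlinarith
    have h4 := (abs_le.1 t2).2
    have h5 : 0 ≤ √l * Real.exp (π * l * v' ^ 2) := by positivity
    nlinarith [mul_le_mul_of_nonneg_left h3 h5]
  have hqq : Real.exp (π * l * v' ^ 2) * (q ^ (2 * n + 1) / (1 - q)) ≤
      Real.exp (π * l * v ^ 2) * (Real.exp (π * M) * Real.exp (-π * l)) := by
    have h3 := inv_one_sub_q hl
    rw [← hq] at h3
    calc _ = Real.exp (π * l * v' ^ 2) * q ^ (2 * n + 1) * (1 / (1 - q)) := by ring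
      _ ≤ Real.exp (π * l * v' ^ 2) * q ^ (2 * n + 1) * Real.exp l := by gcongr
      _ ≤ _ := by
        rw [hq, ← Real.exp_nat_mul, ← Real.exp_add, ← Real.exp_add, ← Real.exp_add, ← Real.exp_add,
          Real.exp_le_exp]
        have e : π * l * v' ^ 2 + ((2 * n + 1 : ℕ) : ℝ) * (-π / l) + l =
          π * l * v ^ 2 - π * v - 3 / 4 * (π / l) - 2 * π * (n / l) + l := by
          rw [hv']
          push_cast
          field_simp
          ring
        rw [e]
        have h6 : l ≤ n / l := by
          rw [le_div_iff₀ hl0]; nlinarith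
        have h7 : 0 < π / l := by positivity
        have h8 := Real.pi_gt_three
        have h9 : -v ≤ M := (neg_le_abs v).trans hv
        have h10 := mul_le_mul_of_nonneg_left h9 Real.pi_pos.le
        have h11 := mul_le_mul_of_nonneg_left h6 Real.pi_pos.le
        have h12 : l ≤ π * l := by nlinarith
        linarith
  rw [hnat, hsum]
  have hd2 : |∑' k, f k * (cc q k - 1)| ≤
      √l * Real.exp (π * l * v ^ 2) * ((1 + C0) * Real.exp (π * M) * Real.exp (-π * l)) := by
    refine hd.trans ?_
    have hp : 0 ≤ q ^ (2 * n + 1) / (1 - q) := by positivity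
    calc _ ≤ √l * Real.exp (π * l * v' ^ 2) * (1 + C0) * (q ^ (2 * n + 1) / (1 - q)) := by gcongr
      _ = √l * (1 + C0) * (Real.exp (π * l * v' ^ 2) * (q ^ (2 * n + 1) / (1 - q))) := by ring
      _ ≤ √l * (1 + C0) * (Real.exp (π * l * v ^ 2) * (Real.exp (π * M) * Real.exp (-π * l))) := by
        gcongr
      _ = _ := by ring
  calc _ = |(∑' m, gt l v m - √l * Real.exp (π * l * v ^ 2)) + ∑' k, f k * (cc q k - 1)| := by
        congr 1; ring
    _ ≤ _ := (abs_add_le _ _).trans (add_le_add t1 hd2)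
    _ = _ := by ring

lemma final {l : ℝ} (hl : 1 ≤ l) (n : ℕ) (hn : l ^ 2 ≤ n) (M v : ℝ) (hv : |v| ≤ M) :
    |(∑' k : ℕ, (Real.exp (-π / l)) ^ (k ^ 2) *
        (-(-(Real.exp (-π / l) ^ (-(4 * (n : ℤ))) * Real.exp (2 * π * v)))) ^ k /
          ∏ j ∈ Finset.range k, (1 - Real.exp (-π / l) ^ (j + 1))) -
      1 / √2 * Real.exp (π * l * (v + 2 * n / l) ^ 2 + π * l / 6 - π / (24 * l))| ≤
    1 / √2 * Real.exp (π * l * (v + 2 * n / l) ^ 2 + π * l / 6 - π / (24 * l)) *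
      ((2 * (C0 + (1 + C0) * Real.exp (π * M) + 2)) * Real.exp (-π * l)) := by
  have hl0 : 0 < l := by linarith
  have hc := core hl n hn M v hv
  have hmod := PI_modular l hl0
  set q := Real.exp (-π / l) with hq
  have hq0 : 0 < q := Real.exp_pos _
  have hq1 : q < 1 := by
    rw [hq, Real.exp_lt_one_iff, neg_div]
    have : 0 < π / l := by positivity
    linarith
  set C1 := C0 + (1 + C0) * Real.exp (π * M) with hC1
  have hC1n : 0 ≤ C1 := by have := C0_nonneg; positivity
  set ε := Real.exp (-π * l) with hε
  have hε0 : 0 < ε := Real.exp_pos _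
  -- the small product
  set r := Real.exp (-4 * π * l) with hr
  have hr0 : 0 < r := Real.exp_pos _
  have hrε : r ≤ ε := by
    rw [hr, hε, Real.exp_le_exp]
    nlinarith [mul_pos Real.pi_pos hl0]
  have hε4 : ε ≤ 1 / 4 := by
    have h1 : 4 ≤ Real.exp (π * l) := by
      have := Real.add_one_le_exp (π * l)
      nlinarith [Real.pi_gt_three]
    rw [hε, neg_mul, Real.exp_neg, inv_eq_one_div]
    exact one_div_le_one_div_of_le (by norm_num) h1
  obtain ⟨b1, b2⟩ := PI_bounds hr0 (by linarith) 0
  simp only [Pk, Finset.range_zero, Finset.prod_empty, one_mul, zero_add, pow_one] at b1 b2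
  have hrr : r / (1 - r) ≤ 2 * ε := by
    rw [div_le_iff₀ (by linarith)]
    nlinarith
  set R := PI r with hR
  have hR2 : 1 / 2 ≤ R := by linarith
  have hR1 : 1 - R ≤ 2 * ε := by linarith
  -- rewriting the series
  set E := Real.exp (4 * π * n ^ 2 / l + 4 * π * n * v) with hE
  have hE0 : 0 < E := Real.exp_pos _
  set B := √(2 * l) * Real.exp (π / (24 * l) - π * l / 6) with hB
  have hB0 : 0 < B := by positivity
  have hP0 : 0 < PI q := by rw [hmod]; positivity
  set T := ∑' k : ℕ, gt l v ((k : ℤ) - 2 * n) * (PI q / Pk q k) with hT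
  have hser : (∑' k : ℕ, q ^ (k ^ 2) *
        (-(-(q ^ (-(4 * (n : ℤ))) * Real.exp (2 * π * v)))) ^ k /
          ∏ j ∈ Finset.range k, (1 - q ^ (j + 1))) = E / PI q * T := by
    rw [hT, ← tsum_mul_left]
    refine tsum_congr (fun k => ?_)
    change _ / Pk q k = _
    have hk := Pk_pos hq0 hq1 k
    have e : q ^ (k ^ 2) * (-(-(q ^ (-(4 * (n : ℤ))) * Real.exp (2 * π * v)))) ^ k =
        E * gt l v ((k : ℤ) - 2 * n) := by
      rw [neg_neg, hq, hE, gt, ← exp_zpow, ← Real.exp_nat_mul, ← Real.exp_add,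
        ← Real.exp_nat_mul, ← Real.exp_add, ← Real.exp_add]
      congr 1
      push_cast
      field_simp
      ring
    rw [e]
    field_simp
  rw [hser]
  set G := Real.exp (π * l * (v + 2 * n / l) ^ 2 + π * l / 6 - π / (24 * l)) with hG
  have hmain : 1 / √2 * G = E / B * (√l * Real.exp (π * l * v ^ 2)) := by
    have e : G = E * Real.exp (π * l * v ^ 2) / Real.exp (π / (24 * l) - π * l / 6) := by
      rw [hG, hE, ← Real.exp_add, ← Real.exp_sub]
      congr 1
      field_simp
      ring
    rw [e, hB, Real.sqrt_mul (by norm_num)]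
    have : 0 < √l := Real.sqrt_pos.2 hl0
    field_simp
  set W := √l * Real.exp (π * l * v ^ 2) with hW
  have hW0 : 0 < W := by have : 0 < √l := Real.sqrt_pos.2 hl0
                         positivity
  rw [hmain, hmod]
  have e1 : E / (B * R) * T - E / B * W = E / (B * R) * ((T - W) + W * (1 - R)) := by
    have : R ≠ 0 := by linarith
    field_simp
    ring
  have hR0 : 0 < R := by linarith
  rw [e1, abs_mul, abs_of_pos (by positivity : 0 < E / (B * R))]
  have h2 : |(T - W) + W * (1 - R)| ≤ W * (C1 + 2) * ε := by
    refine (abs_add_le _ _).trans ?_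
    rw [abs_of_nonneg (mul_nonneg hW0.le (by linarith : 0 ≤ 1 - R))]
    nlinarith [mul_le_mul_of_nonneg_left hR1 hW0.le]
  have h3 : E / (B * R) ≤ E / B * 2 := by
    rw [div_mul_eq_mul_div, div_le_div_iff₀ (by positivity) hB0]
    nlinarith [mul_pos hE0 hB0]
  calc _ ≤ E / B * 2 * (W * (C1 + 2) * ε) := by gcongr
    _ = _ := by ring

/-- Scaled asymptotics for Ramanujan's entire function `A_q(z) = Σ_k q^{k²}(-z)^k/(q;q)_k`:
for an admissible scale `(λ_n)`, `q = e^{-π/λ_n}`, `z = e^{2πv}`,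
`A_q(-q^{-4n} z) = (1/√2) exp{πλ_n (v + 2n/λ_n)² + πλ_n/6 - π/(24λ_n)} (1 + O(e^{-πλ_n}))`
as `n → ∞`, uniformly for `v` in any compact subset of `ℝ`. -/
theorem stmt_19 (lam : ℕ → ℝ) (hpos : ∀ n, 0 < lam n)
    (h1 : Tendsto (fun n : ℕ => lam n / Real.log n) atTop atTop)
    (h2 : Tendsto (fun n : ℕ => (n : ℝ) / (lam n) ^ 2) atTop atTop)
    (K : Set ℝ) (hK : IsCompact K) :
    ∃ C : ℝ, ∃ N : ℕ, ∀ n ≥ N, ∀ v ∈ K,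
      |(∑' k : ℕ, (Real.exp (-Real.pi / lam n)) ^ (k ^ 2) *
            (-(-(Real.exp (-Real.pi / lam n) ^ (-(4 * (n : ℤ))) * Real.exp (2 * Real.pi * v)))) ^ k /
            ∏ j ∈ Finset.range k, (1 - Real.exp (-Real.pi / lam n) ^ (j + 1))) -
          1 / Real.sqrt 2 *
            Real.exp (Real.pi * lam n * (v + 2 * n / lam n) ^ 2 +
              Real.pi * lam n / 6 - Real.pi / (24 * lam n))| ≤
        1 / Real.sqrt 2 *
          Real.exp (Real.pi * lam n * (v + 2 * n / lam n) ^ 2 +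
            Real.pi * lam n / 6 - Real.pi / (24 * lam n)) *
          (C * Real.exp (-Real.pi * lam n)) := by
  obtain ⟨M, hM⟩ := hK.isBounded.exists_norm_le
  have e1 : ∀ᶠ n : ℕ in atTop, 1 ≤ lam n := by
    have hlog : Tendsto (fun n : ℕ => Real.log n) atTop atTop :=
      Real.tendsto_log_atTop.comp tendsto_natCast_atTop_atTop
    filter_upwards [h1.eventually_ge_atTop 1, hlog.eventually_ge_atTop 1] with n a b
    rw [le_div_iff₀ (by linarith)] at a
    linarith
  have e2 : ∀ᶠ n : ℕ in atTop, lam n ^ 2 ≤ n := by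
    filter_upwards [h2.eventually_ge_atTop 1] with n a
    have := hpos n
    rw [le_div_iff₀ (by positivity)] at a
    linarith
  obtain ⟨N, hN⟩ := eventually_atTop.1 (e1.and e2)
  refine ⟨2 * (C0 + (1 + C0) * Real.exp (π * M) + 2), N, fun n hn v hv => ?_⟩
  exact final (hN n hn).1 n (hN n hn).2 M v (hM v hv)
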